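/- Let d ≥ 1 and let x, y ∈ ℝ^d be nonzero vectors. If w is a random vector distributed as the standard Gaussian N(0, I_d) on ℝ^d, then E[ (wᵀx)₊ (wᵀy)₊ ] = (1/(2π)) ‖x‖ ‖y‖ ( sin θ + (π − θ) cos θ ), where θ = arccos( ⟨x,y⟩ / (‖x‖‖y‖) ) is the angle between x and y. (Closed form of the arc-cosine kernel of degree n = 1, i.e., for rectified linear hidden units.) -/

import Mathlib

open MeasureTheory Matrix Real

/-- The standard Gaussian measure `N(0, I_d)` on `ℝ^d`, given by its density
`(2π)^{-d/2} exp(-‖w‖²/2)` w.r.t. Lebesgue measure. -/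
noncomputable def stdGaussian (d : ℕ) : Measure (Fin d → ℝ) :=
  volume.withDensity fun w =>
    ENNReal.ofReal ((2 * π) ^ (-(d : ℝ) / 2) * Real.exp (-(w ⬝ᵥ w) / 2))

open ProbabilityTheory (gaussianReal gaussianPDFReal)

lemma prod_gaussianPDFReal_zero_one {d : ℕ} (w : Fin d → ℝ) :
    ∏ i, gaussianPDFReal 0 1 (w i) =
      (2 * π) ^ (-(d : ℝ) / 2) * Real.exp (-(w ⬝ᵥ w) / 2) := by
  simp only [gaussianPDFReal, Finset.prod_mul_distrib, Finset.prod_const, Finset.card_univ,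
    Fintype.card_fin, ← Real.exp_sum]
  congr 1
  · rw [Real.sqrt_eq_rpow, ← Real.rpow_neg (by positivity), ← Real.rpow_natCast,
      ← Real.rpow_mul (by positivity)]
    congr 1
    · simp
    · ring
  · simp [dotProduct, neg_div, Finset.sum_div, sq]

lemma stdGaussian_eq_pi (d : ℕ) : stdGaussian d = Measure.pi fun _ => gaussianReal 0 1 := by
  refine (Measure.pi_eq fun s hs => ?_).symm
  have hint (i : Fin d) : Integrable (gaussianPDFReal 0 1) (volume.restrict (s i)) :=
    (ProbabilityTheory.integrable_gaussianPDFReal 0 1).restrict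
  rw [stdGaussian, withDensity_apply _ (MeasurableSet.univ_pi hs), volume_pi,
    Measure.restrict_pi_pi]
  simp_rw [← prod_gaussianPDFReal_zero_one]
  rw [← ofReal_integral_eq_lintegral_ofReal (Integrable.fintype_prod hint)
      (ae_of_all _ fun w => Finset.prod_nonneg fun i _ =>
        ProbabilityTheory.gaussianPDFReal_nonneg 0 1 (w i)),
    integral_fintype_prod_eq_prod (fun _ => gaussianPDFReal 0 1),
    ENNReal.ofReal_prod_of_nonneg fun i _ => integral_nonneg fun t =>
      ProbabilityTheory.gaussianPDFReal_nonneg 0 1 t]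
  exact Finset.prod_congr rfl fun i _ =>
    (ProbabilityTheory.gaussianReal_apply_eq_integral 0 one_ne_zero (s i)).symm

instance (d : ℕ) : IsProbabilityMeasure (stdGaussian d) := by
  rw [stdGaussian_eq_pi]
  infer_instance

lemma charFunDual_stdGaussian {d : ℕ} (L : StrongDual ℝ (Fin d → ℝ)) :
    charFunDual (stdGaussian d) L =
      Complex.exp (-((∑ i, L (Pi.single i 1) ^ 2 : ℝ) : ℂ) / 2) := by
  rw [stdGaussian_eq_pi, charFunDual_pi, Complex.ofReal_sum, ← Finset.sum_neg_distrib,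
    Finset.sum_div, Complex.exp_sum]
  refine Finset.prod_congr rfl fun i _ => ?_
  have hL (t : ℝ) : L.comp (.single ℝ _ i) t = L (Pi.single i 1) * t := by
    change L (Pi.single i t) = _
    rw [mul_comm, ← smul_eq_mul t, ← map_smul, ← Pi.single_smul, smul_eq_mul, mul_one]
  have h := ProbabilityTheory.charFun_gaussianReal (μ := 0) (v := 1) (L (Pi.single i 1))
  rw [charFun_apply_real] at h
  simp only [charFunDual_apply, hL, Complex.ofReal_mul, h]
  simp [neg_div]

lemma sum_sq_apply_mulVec_single {m n : ℕ} (A : Matrix (Fin m) (Fin n) ℝ)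
    (L : StrongDual ℝ (Fin m → ℝ)) :
    ∑ i, L (A *ᵥ Pi.single i 1) ^ 2 =
      (fun j => L (Pi.single j 1)) ⬝ᵥ ((A * Aᵀ) *ᵥ fun j => L (Pi.single j 1)) := by
  set v : Fin m → ℝ := fun j => L (Pi.single j 1) with hv
  have hL (u : Fin m → ℝ) : L u = v ⬝ᵥ u := by
    conv_lhs => rw [pi_eq_sum_univ' u]
    simp only [map_sum, map_smul, dotProduct, smul_eq_mul, hv]
    refine Finset.sum_congr rfl fun j _ => ?_
    rw [mul_comm]
  rw [← Matrix.mulVec_mulVec, Matrix.dotProduct_mulVec, ← Matrix.mulVec_transpose]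
  refine Finset.sum_congr rfl fun i _ => ?_
  rw [hL, Matrix.mulVec_single_one, sq, Matrix.mulVec_transpose]
  rfl

/-- The law of a linear image `A w` of a standard Gaussian vector depends only on `A * Aᵀ`. -/
lemma map_mulVec_stdGaussian_eq {k m n : ℕ} (A : Matrix (Fin k) (Fin m) ℝ)
    (B : Matrix (Fin k) (Fin n) ℝ) (h : A * Aᵀ = B * Bᵀ) :
    (stdGaussian m).map (A *ᵥ ·) = (stdGaussian n).map (B *ᵥ ·) := by
  have hA : (A *ᵥ ·) = ⇑(LinearMap.toContinuousLinearMap A.mulVecLin) := rfl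
  have hB : (B *ᵥ ·) = ⇑(LinearMap.toContinuousLinearMap B.mulVecLin) := rfl
  rw [hA, hB]
  have := Measure.isProbabilityMeasure_map (μ := stdGaussian m)
    (LinearMap.toContinuousLinearMap A.mulVecLin).continuous.aemeasurable
  have := Measure.isProbabilityMeasure_map (μ := stdGaussian n)
    (LinearMap.toContinuousLinearMap B.mulVecLin).continuous.aemeasurable
  refine Measure.ext_of_charFunDual (funext fun L => ?_)
  rw [charFunDual_map, charFunDual_map, charFunDual_stdGaussian, charFunDual_stdGaussian]
  simp only [ContinuousLinearMap.comp_apply, LinearMap.coe_toContinuousLinearMap',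
    Matrix.mulVecLin_apply, sum_sq_apply_mulVec_single, h]

lemma integral_Ioi_cube_mul_exp_neg_sq_div_two :
    ∫ r in Set.Ioi (0 : ℝ), r ^ 3 * Real.exp (-r ^ 2 / 2) = 2 := by
  have h := integral_rpow_mul_exp_neg_mul_rpow (p := 2) (q := 3) (b := 1 / 2)
    (by norm_num) (by norm_num) (by norm_num)
  norm_num at h
  refine (setIntegral_congr_fun measurableSet_Ioi fun r _ => ?_).trans h
  ring_nf

lemma integral_max_cos_mul_max_cos_sub {θ : ℝ} (h0 : 0 ≤ θ) (hπ : θ ≤ π) :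
    ∫ φ in Set.Ioo (-π) π, max (Real.cos φ) 0 * max (Real.cos (φ - θ)) 0 =
      (Real.sin θ + (π - θ) * Real.cos θ) / 2 := by
  have hpi := Real.pi_pos
  have hi (a b : ℝ) : IntervalIntegrable
      (fun φ => max (Real.cos φ) 0 * max (Real.cos (φ - θ)) 0) volume a b :=
    (by fun_prop : Continuous _).intervalIntegrable a b
  rw [← integral_Ioc_eq_integral_Ioo, ← intervalIntegral.integral_of_le (by linarith),
    ← intervalIntegral.integral_add_adjacent_intervals (hi (-π) (θ - π / 2)) (hi _ _),
    ← intervalIntegral.integral_add_adjacent_intervals (hi (θ - π / 2) (π / 2)) (hi _ _)]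
  have h1 : ∫ φ in (-π)..(θ - π / 2), max (Real.cos φ) 0 * max (Real.cos (φ - θ)) 0 = 0 := by
    refine (intervalIntegral.integral_congr fun φ hφ => ?_).trans intervalIntegral.integral_zero
    rw [Set.uIcc_of_le (by linarith)] at hφ
    rcases le_total φ (-(π / 2)) with h | h
    · have : Real.cos φ ≤ 0 := by
        rw [← Real.cos_neg]
        exact Real.cos_nonpos_of_pi_div_two_le_of_le (by linarith) (by linarith [hφ.1])
      simp [this]
    · have : Real.cos (φ - θ) ≤ 0 := by
        rw [← Real.cos_neg]
        exact Real.cos_nonpos_of_pi_div_two_le_of_le (by linarith [hφ.2]) (by linarith)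
      simp [this]
  have h3 : ∫ φ in (π / 2)..π, max (Real.cos φ) 0 * max (Real.cos (φ - θ)) 0 = 0 := by
    refine (intervalIntegral.integral_congr fun φ hφ => ?_).trans intervalIntegral.integral_zero
    rw [Set.uIcc_of_le (by linarith)] at hφ
    have : Real.cos φ ≤ 0 :=
      Real.cos_nonpos_of_pi_div_two_le_of_le hφ.1 (by linarith [hφ.2])
    simp [this]
  have h2 : ∫ φ in (θ - π / 2)..(π / 2), max (Real.cos φ) 0 * max (Real.cos (φ - θ)) 0 =
      ∫ φ in (θ - π / 2)..(π / 2), (Real.cos (2 * φ - θ) + Real.cos θ) / 2 := by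
    refine intervalIntegral.integral_congr fun φ hφ => ?_
    rw [Set.uIcc_of_le (by linarith)] at hφ
    have hc : 0 ≤ Real.cos φ :=
      Real.cos_nonneg_of_neg_pi_div_two_le_of_le (by linarith [hφ.1]) hφ.2
    have hc' : 0 ≤ Real.cos (φ - θ) :=
      Real.cos_nonneg_of_neg_pi_div_two_le_of_le (by linarith [hφ.1]) (by linarith [hφ.2])
    have e1 := Real.cos_add φ (φ - θ)
    have e2 := Real.cos_sub φ (φ - θ)
    rw [show φ + (φ - θ) = 2 * φ - θ by ring] at e1
    rw [sub_sub_cancel] at e2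
    simp only [max_eq_left hc, max_eq_left hc']
    linarith
  have hd (φ : ℝ) : HasDerivAt (fun φ => Real.sin (2 * φ - θ) / 4 + φ * Real.cos θ / 2)
      ((Real.cos (2 * φ - θ) + Real.cos θ) / 2) φ := by
    have h := ((((hasDerivAt_id φ).const_mul 2).sub_const θ).sin.div_const 4).fun_add
      (((hasDerivAt_id φ).mul_const (Real.cos θ)).div_const 2)
    exact h.congr_deriv (by simp only [id]; ring)
  rw [h1, h2, h3, intervalIntegral.integral_eq_sub_of_hasDerivAt (fun φ _ => hd φ)
    ((by fun_prop : Continuous _).intervalIntegrable _ _)]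
  rw [show 2 * (π / 2) - θ = π - θ by ring, show 2 * (θ - π / 2) - θ = θ - π by ring,
    Real.sin_pi_sub, Real.sin_sub_pi]
  ring

/-- The arc-cosine kernel of two planar unit vectors at angle `θ`. -/
lemma integral_stdGaussian_two {θ : ℝ} (h0 : 0 ≤ θ) (hπ : θ ≤ π) :
    ∫ w, max (w 0) 0 * max (Real.cos θ * w 0 + Real.sin θ * w 1) 0 ∂(stdGaussian 2) =
      1 / (2 * π) * (Real.sin θ + (π - θ) * Real.cos θ) := by
  have hpi := Real.pi_pos
  rw [stdGaussian, integral_withDensity_eq_integral_toReal_smul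
    (by simp only [dotProduct]; fun_prop) (by simp)]
  have hvol := (volume_preserving_finTwoArrow ℝ).symm.integral_comp'
    (g := fun w : Fin 2 → ℝ => (ENNReal.ofReal ((2 * π) ^ (-((2 : ℕ) : ℝ) / 2) *
      Real.exp (-(w ⬝ᵥ w) / 2))).toReal •
        (max (w 0) 0 * max (Real.cos θ * w 0 + Real.sin θ * w 1) 0))
  rw [← hvol, ← integral_comp_polarCoord_symm, polarCoord_target]
  have hpolar : ∀ p ∈ Set.Ioi (0 : ℝ) ×ˢ Set.Ioo (-π) π,
      p.1 • (fun q : ℝ × ℝ => (ENNReal.ofReal ((2 * π) ^ (-((2 : ℕ) : ℝ) / 2) *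
        Real.exp (-((MeasurableEquiv.finTwoArrow.symm q) ⬝ᵥ
          (MeasurableEquiv.finTwoArrow.symm q)) / 2))).toReal •
        (max ((MeasurableEquiv.finTwoArrow.symm q) 0) 0 *
          max (Real.cos θ * (MeasurableEquiv.finTwoArrow.symm q) 0 +
            Real.sin θ * (MeasurableEquiv.finTwoArrow.symm q) 1) 0)) (polarCoord.symm p) =
      (1 / (2 * π) * (p.1 ^ 3 * Real.exp (-p.1 ^ 2 / 2))) *
        (max (Real.cos p.2) 0 * max (Real.cos (p.2 - θ)) 0) := by
    rintro ⟨r, φ⟩ ⟨hr, -⟩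
    have hr : 0 < r := hr
    have e1 : max (r * Real.cos φ) 0 = r * max (Real.cos φ) 0 := by
      rw [mul_max_of_nonneg _ _ hr.le, mul_zero]
    have e2 : max (Real.cos θ * (r * Real.cos φ) + Real.sin θ * (r * Real.sin φ)) 0 =
        r * max (Real.cos (φ - θ)) 0 := by
      rw [mul_max_of_nonneg _ _ hr.le, mul_zero, Real.cos_sub]
      ring_nf
    have e3 : r * Real.cos φ * (r * Real.cos φ) + r * Real.sin φ * (r * Real.sin φ) = r ^ 2 := by
      linear_combination r ^ 2 * Real.sin_sq_add_cos_sq φ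
    have e4 : (2 * π) ^ (-((2 : ℕ) : ℝ) / 2) = 1 / (2 * π) := by
      norm_num [Real.rpow_neg_one]
    rw [e4]
    simp only [polarCoord_symm_apply, MeasurableEquiv.finTwoArrow, dotProduct, Fin.sum_univ_two,
      smul_eq_mul]
    rw [ENNReal.toReal_ofReal (by positivity)]
    change r * (1 / (2 * π) * Real.exp (-(r * Real.cos φ * (r * Real.cos φ) +
      r * Real.sin φ * (r * Real.sin φ)) / 2) * (max (r * Real.cos φ) 0 *
        max (Real.cos θ * (r * Real.cos φ) + Real.sin θ * (r * Real.sin φ)) 0)) = _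
    rw [e1, e2, e3]
    ring
  rw [setIntegral_congr_fun (measurableSet_Ioi.prod measurableSet_Ioo) hpolar,
    Measure.volume_eq_prod,
    setIntegral_prod_mul (fun r => 1 / (2 * π) * (r ^ 3 * Real.exp (-r ^ 2 / 2)))
      (fun φ => max (Real.cos φ) 0 * max (Real.cos (φ - θ)) 0),
    integral_const_mul, integral_Ioi_cube_mul_exp_neg_sq_div_two,
    integral_max_cos_mul_max_cos_sub h0 hπ]
  ring

/-- **Closed form of the degree-1 arc-cosine kernel (rectified linear units).**
For nonzero `x, y ∈ ℝ^d` and `w ∼ N(0, I_d)`,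
`E[(wᵀx)₊ (wᵀy)₊] = (1/(2π)) ‖x‖ ‖y‖ (sin θ + (π - θ) cos θ)`
where `θ = arccos(⟨x,y⟩/(‖x‖‖y‖))`. -/
theorem statement3 {d : ℕ} (hd : 1 ≤ d) (x y : Fin d → ℝ) (hx : x ≠ 0) (hy : y ≠ 0) :
    ∫ w, max (w ⬝ᵥ x) 0 * max (w ⬝ᵥ y) 0 ∂(stdGaussian d) =
      (1 / (2 * π)) * Real.sqrt (x ⬝ᵥ x) * Real.sqrt (y ⬝ᵥ y) *
        (Real.sin (Real.arccos ((x ⬝ᵥ y) / (Real.sqrt (x ⬝ᵥ x) * Real.sqrt (y ⬝ᵥ y)))) +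
          (π - Real.arccos ((x ⬝ᵥ y) / (Real.sqrt (x ⬝ᵥ x) * Real.sqrt (y ⬝ᵥ y)))) *
            Real.cos (Real.arccos ((x ⬝ᵥ y) / (Real.sqrt (x ⬝ᵥ x) * Real.sqrt (y ⬝ᵥ y))))) := by
  have hxx : 0 < x ⬝ᵥ x := by simpa using Matrix.dotProduct_star_self_pos_iff.mpr hx
  have hyy : 0 < y ⬝ᵥ y := by simpa using Matrix.dotProduct_star_self_pos_iff.mpr hy
  have ha : 0 < √(x ⬝ᵥ x) := Real.sqrt_pos.mpr hxx
  have hb : 0 < √(y ⬝ᵥ y) := Real.sqrt_pos.mpr hyy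
  have ha2 : √(x ⬝ᵥ x) ^ 2 = x ⬝ᵥ x := Real.sq_sqrt hxx.le
  have hb2 : √(y ⬝ᵥ y) ^ 2 = y ⬝ᵥ y := Real.sq_sqrt hyy.le
  set a := √(x ⬝ᵥ x)
  set b := √(y ⬝ᵥ y)
  have hcs : |x ⬝ᵥ y| ≤ a * b := by
    refine abs_le_of_sq_le_sq ?_ (by positivity)
    rw [mul_pow, ha2, hb2]
    simpa [dotProduct, sq] using Finset.sum_mul_sq_le_sq_mul_sq Finset.univ x y
  have hcos : Real.cos (Real.arccos ((x ⬝ᵥ y) / (a * b))) = (x ⬝ᵥ y) / (a * b) := by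
    refine Real.cos_arccos ?_ ?_
    · rw [le_div_iff₀ (by positivity)]
      linarith [neg_le_of_abs_le hcs]
    · rw [div_le_one (by positivity)]
      exact le_of_abs_le hcs
  have h0 := Real.arccos_nonneg ((x ⬝ᵥ y) / (a * b))
  have hπ := Real.arccos_le_pi ((x ⬝ᵥ y) / (a * b))
  set θ := Real.arccos ((x ⬝ᵥ y) / (a * b))
  have hxy : x ⬝ᵥ y = a * b * Real.cos θ := by rw [hcos]; field_simp
  have hAB : (Matrix.of ![x, y]) * (Matrix.of ![x, y])ᵀ =
      !![a, 0; b * Real.cos θ, b * Real.sin θ] *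
        !![a, 0; b * Real.cos θ, b * Real.sin θ]ᵀ := by
    have hA : (Matrix.of ![x, y]) * (Matrix.of ![x, y])ᵀ =
        !![x ⬝ᵥ x, x ⬝ᵥ y; y ⬝ᵥ x, y ⬝ᵥ y] := by
      ext i j
      fin_cases i <;> fin_cases j <;> rfl
    rw [hA, dotProduct_comm y x, ← ha2, ← hb2, hxy]
    ext i j
    fin_cases i <;> fin_cases j <;> simp [Matrix.mul_apply, Fin.sum_univ_two]
    · ring
    · ring
    · ring
    · linear_combination -b ^ 2 * Real.sin_sq_add_cos_sq θ
  have hf : Continuous fun v : Fin 2 → ℝ => max (v 0) 0 * max (v 1) 0 := by fun_prop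
  calc ∫ w, max (w ⬝ᵥ x) 0 * max (w ⬝ᵥ y) 0 ∂(stdGaussian d)
      = ∫ v, max (v 0) 0 * max (v 1) 0 ∂((stdGaussian d).map (Matrix.of ![x, y] *ᵥ ·)) := by
        rw [integral_map (by fun_prop) hf.aestronglyMeasurable]
        simp [Matrix.mulVec, dotProduct_comm]
    _ = ∫ w, a * b * (max (w 0) 0 * max (Real.cos θ * w 0 + Real.sin θ * w 1) 0)
          ∂(stdGaussian 2) := by
        rw [map_mulVec_stdGaussian_eq _ _ hAB,
          integral_map (by fun_prop) hf.aestronglyMeasurable]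
        refine integral_congr_ae (ae_of_all _ fun w => ?_)
        have e1 : max (a * w 0) 0 = a * max (w 0) 0 := by
          rw [mul_max_of_nonneg _ _ ha.le, mul_zero]
        have e2 : max (b * Real.cos θ * w 0 + b * Real.sin θ * w 1) 0 =
            b * max (Real.cos θ * w 0 + Real.sin θ * w 1) 0 := by
          rw [mul_max_of_nonneg _ _ hb.le, mul_zero]
          ring_nf
        simp only [Matrix.mulVec, dotProduct, Fin.sum_univ_two, Matrix.of_apply,
          Matrix.cons_val_zero, Matrix.cons_val_one, zero_mul, add_zero, e1, e2]
        ring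
    _ = _ := by
        rw [integral_const_mul, integral_stdGaussian_two h0 hπ]
        ring
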